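/- arXiv:1707.04338 — 6 statements merged into one kernel-verified Lean document; each statement's English description precedes it below -/
import Mathlib

section
/- Suppose x^{k+1} satisfies the first-order optimality condition ∇f(x^{k+1}) + Aᵀλ^k + Aᵀρ^k A x^k + Q̄(x^{k+1} − x^k) = 0, the multiplier update λ^{k+1} = λ^k + ρ^{k+1} A x^{k+1} holds, ρ^k ⪯ ρ^{k+1} in the Loewner order, and (x*, λ*) is a saddle point of the Lagrangian L. Then: ‖λ^{k+1} − λ*‖²_{(ρ^{k+1})^{-1}} + ‖x^{k+1} − x*‖²_{Q̄} ≤ ‖λ^k − λ*‖²_{(ρ^k)^{-1}} + ‖x^k − x*‖²_{Q̄} − (‖A x^{k+1}‖²_{ρ^k} + ‖x^{k+1} − x^k‖²_{Q̄ − Aᵀρ^k A}) + ‖A x^{k+1}‖²_{ρ^{k+1}} − ‖A x^k‖²_{ρ^k}. -/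
open Matrix

/-- The weighted squared (semi-)norm `‖v‖²_M = vᵀ M v`. -/
noncomputable def msq {ι : Type*} [Fintype ι] (M : Matrix ι ι ℝ) (v : ι → ℝ) : ℝ :=
  v ⬝ᵥ (M *ᵥ v)

/-- First-order lower bound for a differentiable convex function. -/
lemma ConvexOn.add_fderiv_sub_le {V : Type*} [NormedAddCommGroup V] [NormedSpace ℝ V] {f : V → ℝ}
    (hf : ConvexOn ℝ Set.univ f) {x : V} (hd : DifferentiableAt ℝ f x) (y : V) :
    f x + fderiv ℝ f x (y - x) ≤ f y := by
  have hline : ConvexOn ℝ Set.univ (f ∘ AffineMap.lineMap (k := ℝ) x y) := by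
    simpa using hf.comp_affineMap (AffineMap.lineMap (k := ℝ) x y)
  have hderiv : HasDerivAt (f ∘ AffineMap.lineMap (k := ℝ) x y) (fderiv ℝ f x (y - x)) 0 := by
    refine HasFDerivAt.comp_hasDerivAt 0 ?_ AffineMap.hasDerivAt_lineMap
    simpa using hd.hasFDerivAt
  have h := hline.le_slope_of_hasDerivAt (Set.mem_univ 0) (Set.mem_univ 1) zero_lt_one hderiv
  simp only [slope_def_field, Function.comp_apply, AffineMap.lineMap_apply_one,
    AffineMap.lineMap_apply_zero, sub_zero, div_one] at h
  linarith

lemma dotProduct_mulVec_comm_of_isSymm {ι : Type*} [Fintype ι] {M : Matrix ι ι ℝ}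
    (hM : M.IsSymm) (v w : ι → ℝ) : v ⬝ᵥ (M *ᵥ w) = w ⬝ᵥ (M *ᵥ v) := by
  rw [dotProduct_mulVec, ← mulVec_transpose, hM.eq, dotProduct_comm]

lemma msq_add {ι : Type*} [Fintype ι] {M : Matrix ι ι ℝ} (hM : M.IsSymm) (v w : ι → ℝ) :
    msq M (v + w) = msq M v + 2 * (v ⬝ᵥ (M *ᵥ w)) + msq M w := by
  simp only [msq, mulVec_add, add_dotProduct, dotProduct_add,
    dotProduct_mulVec_comm_of_isSymm hM w v]
  ring

lemma msq_sub {ι : Type*} [Fintype ι] {M : Matrix ι ι ℝ} (hM : M.IsSymm) (v w : ι → ℝ) :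
    msq M (v - w) = msq M v - 2 * (v ⬝ᵥ (M *ᵥ w)) + msq M w := by
  simp only [msq, mulVec_sub, sub_dotProduct, dotProduct_sub,
    dotProduct_mulVec_comm_of_isSymm hM w v]
  ring

lemma msq_nonneg {ι : Type*} [Fintype ι] {M : Matrix ι ι ℝ} (hM : M.PosSemidef) (v : ι → ℝ) :
    0 ≤ msq M v := by
  simpa [msq] using hM.dotProduct_mulVec_nonneg v

lemma Matrix.PosDef.isSymm {ι : Type*} {M : Matrix ι ι ℝ} (hM : M.PosDef) : M.IsSymm := by
  simpa [IsHermitian, IsSymm, conjTranspose_eq_transpose_of_trivial] using hM.isHermitian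

lemma Matrix.PosDef.mulVec_inv_mulVec {ι : Type*} [Fintype ι] [DecidableEq ι]
    {M : Matrix ι ι ℝ} (hM : M.PosDef) (v : ι → ℝ) : M *ᵥ (M⁻¹ *ᵥ v) = v := by
  rw [mulVec_mulVec, mul_nonsing_inv _ ((isUnit_iff_isUnit_det _).mp hM.isUnit), one_mulVec]

lemma Matrix.PosDef.inv_mulVec_mulVec {ι : Type*} [Fintype ι] [DecidableEq ι]
    {M : Matrix ι ι ℝ} (hM : M.PosDef) (v : ι → ℝ) : M⁻¹ *ᵥ (M *ᵥ v) = v := by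
  rw [mulVec_mulVec, nonsing_inv_mul _ ((isUnit_iff_isUnit_det _).mp hM.isUnit), one_mulVec]

/-- Inversion is antitone in the Loewner order on positive definite matrices. -/
lemma msq_inv_le_msq_inv {ι : Type*} [Fintype ι] [DecidableEq ι] {M P : Matrix ι ι ℝ}
    (hM : M.PosDef) (hP : P.PosDef) (hle : (P - M).PosSemidef) (v : ι → ℝ) :
    msq P⁻¹ v ≤ msq M⁻¹ v := by
  have hsq := msq_nonneg hM.posSemidef (P⁻¹ *ᵥ v - M⁻¹ *ᵥ v)
  have hdiff := msq_nonneg hle (P⁻¹ *ᵥ v)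
  rw [msq_sub hM.isSymm, hM.mulVec_inv_mulVec] at hsq
  simp only [msq, sub_mulVec, dotProduct_sub, hM.mulVec_inv_mulVec, hP.mulVec_inv_mulVec,
    dotProduct_comm _ v] at hsq hdiff ⊢
  linarith

/-- Theorem 3 of the paper: the per-iteration contraction inequality for
the ADMM with time-varying penalty matrices. -/
theorem admm_contraction_inequality
    (N D E : ℕ) (hN : 0 < N) (hD : 0 < D) (hE : 0 < E)
    (f : (Fin (N * D) → ℝ) → ℝ) (gf : (Fin (N * D) → ℝ) → (Fin (N * D) → ℝ))
    (hconv : ConvexOn ℝ Set.univ f) (hsmooth : ContDiff ℝ 1 f)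
    (hgrad : ∀ x v, fderiv ℝ f x v = gf x ⬝ᵥ v)
    (A : Matrix (Fin (E * D)) (Fin (N * D)) ℝ)
    (xk xk1 xs : Fin (N * D) → ℝ) (lk lk1 ls : Fin (E * D) → ℝ)
    (ρk ρk1 : Matrix (Fin (E * D)) (Fin (E * D)) ℝ)
    (hρk : ρk.PosDef) (hρkdiag : ρk.IsDiag)
    (hρk1 : ρk1.PosDef) (hρk1diag : ρk1.IsDiag)
    (hρle : (ρk1 - ρk).PosSemidef)
    (Q : Matrix (Fin (N * D)) (Fin (N * D)) ℝ) (hQ : Q.IsSymm)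
    (hopt : gf xk1 + Aᵀ *ᵥ lk + Aᵀ *ᵥ (ρk *ᵥ (A *ᵥ xk)) + Q *ᵥ (xk1 - xk) = 0)
    (hlam : lk1 = lk + ρk1 *ᵥ (A *ᵥ xk1))
    (hsaddle : ∀ (x : Fin (N * D) → ℝ) (l : Fin (E * D) → ℝ),
      f xs + l ⬝ᵥ (A *ᵥ xs) ≤ f xs + ls ⬝ᵥ (A *ᵥ xs) ∧
      f xs + ls ⬝ᵥ (A *ᵥ xs) ≤ f x + ls ⬝ᵥ (A *ᵥ x)) :
    msq ρk1⁻¹ (lk1 - ls) + msq Q (xk1 - xs)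
    ≤ msq ρk⁻¹ (lk - ls) + msq Q (xk - xs)
      - (msq ρk (A *ᵥ xk1) + msq (Q - Aᵀ * ρk * A) (xk1 - xk))
      + msq ρk1 (A *ᵥ xk1) - msq ρk (A *ᵥ xk) := by
  have hAxs : A *ᵥ xs = 0 := by
    have h := (hsaddle xs (ls + A *ᵥ xs)).1
    rw [add_dotProduct] at h
    have hnonneg : 0 ≤ (A *ᵥ xs) ⬝ᵥ (A *ᵥ xs) :=
      Finset.sum_nonneg fun i _ => mul_self_nonneg _
    exact dotProduct_self_eq_zero.mp (by linarith)
  have hmono : (lk - ls) ⬝ᵥ (A *ᵥ xk1) + (A *ᵥ xk1) ⬝ᵥ (ρk *ᵥ (A *ᵥ xk))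
      + (xk1 - xs) ⬝ᵥ (Q *ᵥ (xk1 - xk)) ≤ 0 := by
    have hgi := hconv.add_fderiv_sub_le (hsmooth.differentiable one_ne_zero xk1) xs
    rw [hgrad, ← neg_sub xk1 xs, dotProduct_neg, dotProduct_comm] at hgi
    have hmin := (hsaddle xk1 ls).2
    rw [hAxs, dotProduct_zero] at hmin
    have hA (l : Fin (E * D) → ℝ) : (xk1 - xs) ⬝ᵥ (Aᵀ *ᵥ l) = (A *ᵥ xk1) ⬝ᵥ l := by
      rw [dotProduct_mulVec, vecMul_transpose, mulVec_sub, hAxs, sub_zero]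
    have hst := congrArg (fun v => (xk1 - xs) ⬝ᵥ v) hopt
    simp only [dotProduct_add, hA, dotProduct_zero] at hst
    rw [sub_dotProduct, dotProduct_comm lk]
    linarith
  have hl : msq ρk1⁻¹ (lk1 - ls)
      = msq ρk1⁻¹ (lk - ls) + 2 * ((lk - ls) ⬝ᵥ (A *ᵥ xk1)) + msq ρk1 (A *ᵥ xk1) := by
    rw [hlam, add_sub_right_comm, msq_add hρk1.inv.isSymm, hρk1.inv_mulVec_mulVec]
    simp only [msq, hρk1.inv_mulVec_mulVec, dotProduct_comm (A *ᵥ xk1)]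
  have hx : msq Q (xk - xs) = msq Q (xk1 - xs)
      - 2 * ((xk1 - xs) ⬝ᵥ (Q *ᵥ (xk1 - xk))) + msq Q (xk1 - xk) := by
    rw [← msq_sub hQ, sub_sub_sub_cancel_left]
  have hd : msq (Q - Aᵀ * ρk * A) (xk1 - xk)
      = msq Q (xk1 - xk) - msq ρk (A *ᵥ xk1 - A *ᵥ xk) := by
    simp only [msq, sub_mulVec, dotProduct_sub, ← mulVec_sub, ← mulVec_mulVec]
    rw [dotProduct_mulVec _ Aᵀ, vecMul_transpose]
  have hinv := msq_inv_le_msq_inv hρk hρk1 hρle (lk - ls)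
  rw [hl, hx, hd, msq_sub hρk.isSymm]
  linarith
end

section
/- Suppose the ADMM iterates (x^k, λ^k)_{k∈ℕ} satisfy, for every k, the first-order optimality condition ∇f(x^{k+1}) + Aᵀλ^k + Aᵀρ^k A x^k + Q̄(x^{k+1} − x^k) = 0 and the multiplier update λ^{k+1} = λ^k + ρ^{k+1} A x^{k+1}; suppose Condition A holds (ρ^0 ⪯ ρ^k ⪯ ρ^{k+1} ⪯ ρ̄ for all k, with all ρ^k and ρ̄ diagonal positive definite), Condition B holds (Q̄ − Aᵀρ̄A is positive definite), and (x*, λ*) is a saddle point of the Lagrangian L. Define the ergodic average x̄^{t+1} = (1/(t+1)) Σ_{k=0}^{t} x^{k+1}. Then there exists a constant C ≥ 0, independent of t, such that for every t ∈ ℕ: f(x̄^{t+1}) + (λ*)ᵀA x̄^{t+1} − f(x*) ≤ C/(t+1). In other words, the algorithm converges at rate O(1/t). -/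
open Matrix

/-- First-order characterisation of convexity: a convex function lies above its tangents. -/
theorem ConvexOn.sub_le_fderiv {V : Type*} [NormedAddCommGroup V] [NormedSpace ℝ V] {f : V → ℝ}
    (hf : ConvexOn ℝ Set.univ f) {y : V} (hd : DifferentiableAt ℝ f y) (z : V) :
    f y - f z ≤ fderiv ℝ f y (y - z) := by
  have hg : ConvexOn ℝ Set.univ (f ∘ AffineMap.lineMap (k := ℝ) y z) := by
    simpa using hf.comp_affineMap (AffineMap.lineMap (k := ℝ) y z)
  have hder : HasDerivAt (f ∘ AffineMap.lineMap (k := ℝ) y z) (fderiv ℝ f y (z - y)) 0 := by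
    refine HasFDerivAt.comp_hasDerivAt (0 : ℝ) ?_ AffineMap.hasDerivAt_lineMap
    simpa using hd.hasFDerivAt
  have h := hg.le_slope_of_hasDerivAt (Set.mem_univ 0) (Set.mem_univ 1) zero_lt_one hder
  simp only [slope_def_field, Function.comp_apply, AffineMap.lineMap_apply_zero,
    AffineMap.lineMap_apply_one, sub_zero, div_one] at h
  rw [← neg_sub z y, map_neg]
  linarith

/-- Jensen's inequality for ergodic averages: if the excesses of a convex function along a sequence
are bounded by the decrements of a nonnegative sequence, its averages converge at rate `O(1/t)`. -/
theorem ConvexOn.map_average_sub_le {V : Type*} [AddCommGroup V] [Module ℝ V] {g : V → ℝ}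
    (hg : ConvexOn ℝ Set.univ g) {u : ℕ → V} {c : ℝ} {v : ℕ → ℝ} (hv : ∀ k, 0 ≤ v k)
    (h : ∀ k, g (u k) - c ≤ v k - v (k + 1)) (t : ℕ) :
    g (((t : ℝ) + 1)⁻¹ • ∑ k ∈ Finset.range (t + 1), u k) - c ≤ v 0 / ((t : ℝ) + 1) := by
  have ht : (0 : ℝ) < (t : ℝ) + 1 := by positivity
  have hJ : g (∑ k ∈ Finset.range (t + 1), ((t : ℝ) + 1)⁻¹ • u k)
      ≤ ∑ k ∈ Finset.range (t + 1), ((t : ℝ) + 1)⁻¹ • g (u k) :=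
    hg.map_sum_le (fun _ _ => by positivity)
      (by simp [Finset.sum_const, mul_inv_cancel₀ ht.ne']) (fun _ _ => Set.mem_univ _)
  have hS : ∑ k ∈ Finset.range (t + 1), (g (u k) - c) ≤ v 0 - v (t + 1) :=
    (Finset.sum_le_sum fun k _ => h k).trans_eq (Finset.sum_range_sub' v (t + 1))
  rw [Finset.sum_sub_distrib, Finset.sum_const, Finset.card_range, nsmul_eq_mul] at hS
  push_cast at hS
  rw [← Finset.smul_sum, ← Finset.smul_sum, smul_eq_mul, inv_mul_eq_div, le_div_iff₀ ht] at hJ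
  rw [le_div_iff₀ ht]
  linarith [hv (t + 1)]

namespace Matrix

variable {m n : Type*} [Fintype m] [Fintype n]

/-- Polarisation identity for a symmetric bilinear form, in terms of `u` and `v - u`. -/
theorem IsSymm.two_mul_mulVec_sub_dotProduct {M : Matrix n n ℝ} (hM : M.IsSymm) (u v : n → ℝ) :
    2 * ((M *ᵥ (u - v)) ⬝ᵥ u)
      = u ⬝ᵥ M *ᵥ u - v ⬝ᵥ M *ᵥ v + (u - v) ⬝ᵥ M *ᵥ (u - v) := by
  have h : v ⬝ᵥ M *ᵥ u = u ⬝ᵥ M *ᵥ v := by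
    rw [dotProduct_mulVec, ← mulVec_transpose, hM.eq, dotProduct_comm]
  rw [dotProduct_comm (M *ᵥ (u - v))]
  simp only [mulVec_sub, sub_dotProduct, dotProduct_sub]
  linarith

theorem PosSemidef.dotProduct_mulVec_le {M M' : Matrix n n ℝ} (h : (M' - M).PosSemidef)
    (v : n → ℝ) : v ⬝ᵥ M *ᵥ v ≤ v ⬝ᵥ M' *ᵥ v := by
  have := h.dotProduct_mulVec_nonneg v
  simp only [star_trivial, sub_mulVec, dotProduct_sub] at this
  linarith

theorem dotProduct_transpose_mul_mul_mulVec (M : Matrix m m ℝ) (A : Matrix m n ℝ) (v : n → ℝ) :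
    v ⬝ᵥ (Aᵀ * M * A) *ᵥ v = (A *ᵥ v) ⬝ᵥ M *ᵥ (A *ᵥ v) := by
  rw [← mulVec_mulVec, ← mulVec_mulVec, dotProduct_mulVec, vecMul_transpose]

theorem IsDiag.mulVec_apply {M : Matrix n n ℝ} (hM : M.IsDiag) (v : n → ℝ) (i : n) :
    (M *ᵥ v) i = M i i * v i := by
  classical
  conv_lhs => rw [← hM.diagonal_diag]
  rw [mulVec_diagonal, diag_apply]

/-- Multiplier estimate: the squared distance weighted by the inverse of a diagonal penalty matrix
changes in a controlled way along a step `R' *ᵥ a`, when the penalties increase from `R` to `R'`. -/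
theorem neg_two_mul_dotProduct_le_of_isDiag {R R' : Matrix n n ℝ} (hR : R.PosDef)
    (hR' : R'.PosDef) (hdiag : R'.IsDiag) (hle : (R' - R).PosSemidef) {p p' a : n → ℝ}
    (hp : p' = p + R' *ᵥ a) :
    -2 * (p ⬝ᵥ a) ≤ ∑ i, p i ^ 2 / R i i - ∑ i, p' i ^ 2 / R' i i + a ⬝ᵥ R' *ᵥ a := by
  simp only [dotProduct]
  rw [Finset.mul_sum, ← Finset.sum_sub_distrib, ← Finset.sum_add_distrib]
  refine Finset.sum_le_sum fun i _ => ?_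
  have h0 : 0 < R i i := hR.diag_pos
  have h1 : 0 < R' i i := hR'.diag_pos
  have h2 : R i i ≤ R' i i := sub_nonneg.mp hle.diag_nonneg
  have h3 : p i ^ 2 / R' i i ≤ p i ^ 2 / R i i :=
    div_le_div_of_nonneg_left (sq_nonneg _) h0 h2
  have h4 : p' i ^ 2 / R' i i
      = p i ^ 2 / R' i i + 2 * (p i * a i) + a i * (R' i i * a i) := by
    rw [hp, Pi.add_apply, hdiag.mulVec_apply]
    field_simp
    ring
  rw [hdiag.mulVec_apply]
  linarith

end Matrix

/-- Theorem 2 of the paper: the ergodic averages of the ADMM iterates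
converge at rate `O(1/t)` in terms of the Lagrangian gap. -/
theorem admm_convergence_rate
    (N D E : ℕ) (hN : 0 < N) (hD : 0 < D) (hE : 0 < E)
    (f : (Fin (N * D) → ℝ) → ℝ) (gf : (Fin (N * D) → ℝ) → (Fin (N * D) → ℝ))
    (hconv : ConvexOn ℝ Set.univ f) (hsmooth : ContDiff ℝ 1 f)
    (hgrad : ∀ x v, fderiv ℝ f x v = gf x ⬝ᵥ v)
    (A : Matrix (Fin (E * D)) (Fin (N * D)) ℝ)
    (x : ℕ → (Fin (N * D) → ℝ)) (l : ℕ → (Fin (E * D) → ℝ))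
    (ρ : ℕ → Matrix (Fin (E * D)) (Fin (E * D)) ℝ)
    (ρbar : Matrix (Fin (E * D)) (Fin (E * D)) ℝ)
    (Q : Matrix (Fin (N * D)) (Fin (N * D)) ℝ) (hQ : Q.IsSymm)
    -- iterates
    (hopt : ∀ k, gf (x (k + 1)) + Aᵀ *ᵥ (l k) + Aᵀ *ᵥ (ρ k *ᵥ (A *ᵥ x k))
      + Q *ᵥ (x (k + 1) - x k) = 0)
    (hlam : ∀ k, l (k + 1) = l k + ρ (k + 1) *ᵥ (A *ᵥ x (k + 1)))
    -- Condition A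
    (hρdiag : ∀ k, (ρ k).IsDiag) (hρpos : ∀ k, (ρ k).PosDef)
    (hρbardiag : ρbar.IsDiag) (hρbarpos : ρbar.PosDef)
    (hρmono : ∀ k, (ρ (k + 1) - ρ k).PosSemidef)
    (hρ0 : ∀ k, (ρ k - ρ 0).PosSemidef)
    (hρbar : ∀ k, (ρbar - ρ k).PosSemidef)
    -- Condition B
    (hB : (Q - Aᵀ * ρbar * A).PosDef)
    -- saddle point
    (xs : Fin (N * D) → ℝ) (ls : Fin (E * D) → ℝ)
    (hsaddle : ∀ (y : Fin (N * D) → ℝ) (μ : Fin (E * D) → ℝ),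
      f xs + μ ⬝ᵥ (A *ᵥ xs) ≤ f xs + ls ⬝ᵥ (A *ᵥ xs) ∧
      f xs + ls ⬝ᵥ (A *ᵥ xs) ≤ f y + ls ⬝ᵥ (A *ᵥ y)) :
    ∃ C : ℝ, 0 ≤ C ∧ ∀ t : ℕ,
      f (((t : ℝ) + 1)⁻¹ • ∑ k ∈ Finset.range (t + 1), x (k + 1))
        + ls ⬝ᵥ (A *ᵥ (((t : ℝ) + 1)⁻¹ • ∑ k ∈ Finset.range (t + 1), x (k + 1)))
        - f xs
      ≤ C / ((t : ℝ) + 1) := by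
  have hA : A *ᵥ xs = 0 := by
    have h := (hsaddle xs (ls + A *ᵥ xs)).1
    rw [add_dotProduct] at h
    have h' : (A *ᵥ xs) ⬝ᵥ (A *ᵥ xs) = 0 :=
      le_antisymm (by linarith) (by simpa using dotProduct_star_self_nonneg (A *ᵥ xs))
    exact dotProduct_self_eq_zero.mp h'
  have hquad (k : ℕ) (v : Fin (N * D) → ℝ) :
      (A *ᵥ v) ⬝ᵥ ρ k *ᵥ (A *ᵥ v) ≤ v ⬝ᵥ Q *ᵥ v :=
    ((hρbar k).dotProduct_mulVec_le _).trans <| by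
      rw [← dotProduct_transpose_mul_mul_mulVec]
      exact hB.posSemidef.dotProduct_mulVec_le v
  have hAd (k : ℕ) : A *ᵥ (x k - xs) = A *ᵥ x k := by rw [mulVec_sub, hA, sub_zero]
  let V : ℕ → ℝ := fun k => ((∑ i, (l k - ls) i ^ 2 / ρ k i i)
    + (x k - xs) ⬝ᵥ Q *ᵥ (x k - xs) - (A *ᵥ x k) ⬝ᵥ ρ k *ᵥ (A *ᵥ x k)) / 2
  have hV (k : ℕ) : 0 ≤ V k := by
    have h1 := hquad k (x k - xs)
    rw [hAd] at h1
    have h2 : 0 ≤ ∑ i, (l k - ls) i ^ 2 / ρ k i i :=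
      Finset.sum_nonneg fun i _ => div_nonneg (sq_nonneg _) (hρpos k).diag_pos.le
    simp only [V]
    linarith
  let g : (Fin (N * D) → ℝ) → ℝ := fun y => f y + ls ⬝ᵥ (A *ᵥ y)
  have hg : ConvexOn ℝ Set.univ g :=
    hconv.add (((dotProductBilin ℝ ℝ ls).comp A.mulVecLin).convexOn convex_univ)
  have hstep (k : ℕ) : g (x (k + 1)) - f xs ≤ V k - V (k + 1) := by
    have hgap := hconv.sub_le_fderiv ((hsmooth.differentiable one_ne_zero) (x (k + 1))) xs
    rw [hgrad] at hgap
    have hstat := congrArg (· ⬝ᵥ (x (k + 1) - xs)) (hopt k)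
    simp only [add_dotProduct, zero_dotProduct, mulVec_transpose, ← dotProduct_mulVec, hAd]
      at hstat
    have hQstep := hQ.two_mul_mulVec_sub_dotProduct (x (k + 1) - xs) (x k - xs)
    rw [sub_sub_sub_cancel_right] at hQstep
    have hρsymm : (ρ k).IsSymm := (hρdiag k).isSymm
    have hρstep := hρsymm.two_mul_mulVec_sub_dotProduct (A *ᵥ x (k + 1)) (A *ᵥ x k)
    rw [mulVec_sub (ρ k), sub_dotProduct, ← mulVec_sub (ρ k),
      dotProduct_comm (ρ k *ᵥ (A *ᵥ x (k + 1)))] at hρstep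
    have hdiff := hquad k (x (k + 1) - x k)
    rw [mulVec_sub A] at hdiff
    have hmult := neg_two_mul_dotProduct_le_of_isDiag (hρpos k) (hρpos (k + 1)) (hρdiag (k + 1))
      (hρmono k) (p := l k - ls) (p' := l (k + 1) - ls) (a := A *ᵥ x (k + 1))
      (by rw [hlam k]; abel)
    rw [sub_dotProduct] at hmult
    have hnn := (hρpos k).posSemidef.dotProduct_mulVec_nonneg (A *ᵥ x (k + 1))
    rw [star_trivial] at hnn
    simp only [V, g]
    linarith
  exact ⟨V 0, hV 0, fun t => hg.map_average_sub_le (u := fun k => x (k + 1)) hV hstep t⟩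
end

section
/- Fix K ∈ ℕ, vectors x_i^0, …, x_i^K ∈ ℝ^D, positive reals b^0, …, b^K (agent i's own weights b_{i→j}^k), and observations y^0, …, y^K ∈ ℝ^D. Call a pair of sequences ((c^k)_{k=0}^K, (z^k)_{k=0}^K), with each c^k > 0 real and z^k ∈ ℝ^D, consistent if y^k = b^k · c^k · (z^k − x_i^k) for all k = 0, …, K. Then: (1) for every consistent pair ((c^k), (z^k)) and every index κ with y^κ ≠ 0, there exists another consistent pair ((c̃^k), (z̃^k)) with z̃^κ ≠ z^κ, so the neighbor's state z^κ cannot be uniquely inferred from the observations; (2) conversely, if y^κ = 0 then every consistent pair satisfies z^κ = x_i^κ. -/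
/-- Theorem 5 of the paper: privacy of intermediate states.  Agent `i`
observes `y^k = b^k c^k (z^k − x_i^k)` where `c^k > 0` (the neighbor's weight) and
`z^k` (the neighbor's state) are unknown. (1) Whenever `y^κ ≠ 0`, any consistent pair
of unknowns can be replaced by another consistent pair with a different neighbor state
at step `κ`, so the state cannot be uniquely inferred; (2) if `y^κ = 0` then every
consistent pair satisfies `z^κ = x_i^κ`. -/
theorem state_privacy
    (D K : ℕ) (xi y : Fin (K + 1) → (Fin D → ℝ))
    (b : Fin (K + 1) → ℝ) (hb : ∀ k, 0 < b k) :
    (∀ (c : Fin (K + 1) → ℝ) (z : Fin (K + 1) → (Fin D → ℝ)),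
      (∀ k, 0 < c k) → (∀ k, y k = (b k * c k) • (z k - xi k)) →
      ∀ κ : Fin (K + 1), y κ ≠ 0 →
        ∃ (c' : Fin (K + 1) → ℝ) (z' : Fin (K + 1) → (Fin D → ℝ)),
          (∀ k, 0 < c' k) ∧ (∀ k, y k = (b k * c' k) • (z' k - xi k)) ∧
          z' κ ≠ z κ) ∧
    (∀ (c : Fin (K + 1) → ℝ) (z : Fin (K + 1) → (Fin D → ℝ)),
      (∀ k, 0 < c k) → (∀ k, y k = (b k * c k) • (z k - xi k)) →
      ∀ κ : Fin (K + 1), y κ = 0 → z κ = xi κ) := by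
  refine ⟨fun c z hc h κ hκ => ?_, fun c z hc h κ hκ => ?_⟩
  · refine ⟨fun k => 2 * c k, fun k => xi k + (1 / 2 : ℝ) • (z k - xi k),
      fun k => mul_pos two_pos (hc k), fun k => ?_, fun heq => hκ ?_⟩
    · rw [h k, add_sub_cancel_left, smul_smul]
      congr 1
      ring
    · have hz : z κ - xi κ = 0 := by
        ext d
        have hd := congrFun heq d
        simp only [Pi.add_apply, Pi.smul_apply, Pi.sub_apply, smul_eq_mul, Pi.zero_apply] at hd ⊢
        linarith
      rw [h κ, hz, smul_zero]
  · rw [h κ, smul_eq_zero_iff_right (mul_pos (hb κ) (hc κ)).ne'] at hκ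
    exact sub_eq_zero.mp hκ
end

section
/- Fix K ≥ 1, γ > 0, vectors x^0, …, x^K ∈ ℝ^D, and neighbor-aggregate terms s^0, …, s^{K−1} ∈ ℝ^D. Define multipliers λ^k = −Σ_{t=0}^{k} s^t and gradient values g^{k+1} = −(1+γ) x^{k+1} − λ^k + s^k + (1+γ) x^k for k = 0, …, K−1, so that the ADMM update equations g^{k+1} + (1+γ) x^{k+1} + λ^k − s^k − (1+γ) x^k = 0 hold. Then for every δ ∈ ℝ^D with δ ≠ 0 there exist alternative terms s̃^0, …, s̃^{K−1} ∈ ℝ^D, with associated λ̃^k = −Σ_{t=0}^{k} s̃^t and g̃^{k+1} = −(1+γ) x^{k+1} − λ̃^k + s̃^k + (1+γ) x^k, such that the same update equations hold and g̃^k ≠ g^k for every k = 1, …, K. (Concretely, s̃^k = s^k + δ yields g̃^{k+1} − g^{k+1} = (k+2)δ.) Hence the gradients ∇f_j(x_j^k) are not uniquely determined by the data observable to an honest-but-curious neighbor when the neighbor-aggregate terms s^k are unknown. -/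
/-- Theorem 6 of the paper: privacy of gradients.  With the multipliers
`λ^k = −Σ_{t≤k} s^t` and gradient values `g^{k+1}` determined by the ADMM update
equations, any nonzero perturbation `δ` of the unknown neighbor-aggregate terms `s^k`
yields alternative multipliers and gradient values that satisfy the same update
equations but differ from the true gradients at every step `1 ≤ k ≤ K`. -/
theorem gradient_privacy
    (D K : ℕ) (hK : 1 ≤ K) (γ : ℝ) (hγ : 0 < γ)
    (x s lam g : ℕ → (Fin D → ℝ))
    (hlam : ∀ k, lam k = -(∑ t ∈ Finset.range (k + 1), s t))
    (hg : ∀ k < K, g (k + 1) =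
      -((1 + γ) • x (k + 1)) - lam k + s k + (1 + γ) • x k) :
    ∀ δ : Fin D → ℝ, δ ≠ 0 →
      ∃ s' lam' g' : ℕ → (Fin D → ℝ),
        (∀ k, lam' k = -(∑ t ∈ Finset.range (k + 1), s' t)) ∧
        (∀ k < K, g' (k + 1) =
          -((1 + γ) • x (k + 1)) - lam' k + s' k + (1 + γ) • x k) ∧
        (∀ k < K,
          g' (k + 1) + (1 + γ) • x (k + 1) + lam' k - s' k - (1 + γ) • x k = 0) ∧
        (∀ k, 1 ≤ k → k ≤ K → g' k ≠ g k) := by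
  intro δ hδ
  refine ⟨fun k => s k + δ, fun k => lam k - ((k : ℝ) + 1) • δ,
    fun k => g k + ((k : ℝ) + 1) • δ, fun k => ?_, fun k hk => ?_, fun k hk => ?_,
    fun k _ _ h => ?_⟩
  · simp only [hlam, Finset.sum_add_distrib, Finset.sum_const, Finset.card_range,
      ← Nat.cast_smul_eq_nsmul ℝ]
    push_cast
    module
  · simp only [hg k hk]
    push_cast
    module
  · simp only [hg k hk]
    push_cast
    module
  · exact smul_ne_zero (by positivity) hδ (add_eq_left.mp h)
end

section
/- Let p and q be distinct primes, n = pq, and suppose gcd(n, (p−1)(q−1)) = 1. Let λ = (p−1)(q−1), let g = n + 1, let m be a natural number with m < n, and let r be a natural number coprime to n. Let c be any natural number with c ≡ g^m · r^n (mod n²) (a Paillier ciphertext of m), and let u be the unique representative of c^λ modulo n² with 0 ≤ u < n². Then n divides u − 1, and ((u − 1)/n) · μ ≡ m (mod n), where μ is the multiplicative inverse of λ modulo n. In other words, Paillier decryption of a Paillier encryption of m recovers m. -/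
/-- First-order binomial expansion modulo `n²`. -/
theorem one_add_mul_pow_modEq_sq (n k j : ℕ) :
    (1 + n * k) ^ j ≡ 1 + n * (j * k) [MOD n ^ 2] := by
  induction j with
  | zero => simp [Nat.ModEq.refl]
  | succ j ih =>
    have h := ih.mul_right (1 + n * k)
    rw [← pow_succ] at h
    refine h.trans ?_
    have e : (1 + n * (j * k)) * (1 + n * k) =
        1 + n * ((j + 1) * k) + n ^ 2 * (j * k * k) := by ring
    rw [e]
    simp [Nat.ModEq]

/-- Euler's theorem for a product of two primes, lifted to the square of the modulus. -/
theorem pow_mul_pow_modEq_one_sq {p q r : ℕ} (hp : p.Prime) (hq : q.Prime) (hpq : p ≠ q)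
    (hr : Nat.Coprime r (p * q)) :
    (r ^ ((p - 1) * (q - 1))) ^ (p * q) ≡ 1 [MOD (p * q) ^ 2] := by
  have euler := Nat.ModEq.pow_totient hr
  rw [Nat.totient_mul ((Nat.coprime_primes hp hq).2 hpq), Nat.totient_prime hp,
    Nat.totient_prime hq] at euler
  have hpos : 0 < r := by
    rcases Nat.eq_zero_or_pos r with rfl | h
    · have h1 : p * q = 1 := by simpa using hr
      exact absurd (Nat.eq_one_of_mul_eq_one_right h1) hp.one_lt.ne'
    · exact h
  have hle : 1 ≤ r ^ ((p - 1) * (q - 1)) := Nat.pow_pos hpos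
  obtain ⟨k, hk⟩ := (Nat.modEq_iff_dvd' hle).1 euler.symm
  have hk' : r ^ ((p - 1) * (q - 1)) = 1 + p * q * k := by omega
  rw [hk']
  refine (one_add_mul_pow_modEq_sq (p * q) k (p * q)).trans ?_
  have e : 1 + p * q * (p * q * k) = 1 + (p * q) ^ 2 * k := by ring
  rw [e]
  simp [Nat.ModEq]

/-- correctness of Paillier decryption.  For `n = pq` a product of two
distinct primes with `gcd(n, (p−1)(q−1)) = 1`, `g = n + 1`, plaintext `m < n`,
randomness `r` coprime to `n`, the decryption `L(c^λ mod n²) · μ mod n` of a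
ciphertext `c ≡ g^m r^n (mod n²)` recovers `m`, where `λ = (p−1)(q−1)`,
`μ ≡ λ⁻¹ (mod n)`, and `L(u) = (u − 1)/n`. -/
theorem paillier_decryption_correct
    (p q : ℕ) (hp : p.Prime) (hq : q.Prime) (hpq : p ≠ q)
    (n : ℕ) (hn : n = p * q)
    (hco : Nat.gcd n ((p - 1) * (q - 1)) = 1)
    (lam : ℕ) (hlam : lam = (p - 1) * (q - 1))
    (m : ℕ) (hm : m < n)
    (r : ℕ) (hr : Nat.Coprime r n)
    (c : ℕ) (hc : c ≡ (n + 1) ^ m * r ^ n [MOD n ^ 2])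
    (u : ℕ) (hu : u = c ^ lam % n ^ 2)
    (μ : ℕ) (hμ : μ * lam ≡ 1 [MOD n]) :
    n ∣ u - 1 ∧ ((u - 1) / n) * μ ≡ m [MOD n] := by
  have hn1 : 1 < n := hn ▸ one_lt_mul'' hp.one_lt hq.one_lt
  have hrn : (r ^ lam) ^ n ≡ 1 [MOD n ^ 2] := by
    subst hn hlam
    exact pow_mul_pow_modEq_one_sq hp hq hpq hr
  have hg : (n + 1) ^ (m * lam) ≡ 1 + n * (m * lam) [MOD n ^ 2] := by
    simpa [add_comm] using one_add_mul_pow_modEq_sq n 1 (m * lam)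
  have hu' : u ≡ 1 + n * (m * lam) [MOD n ^ 2] := by
    have e : ((n + 1) ^ m * r ^ n) ^ lam = (n + 1) ^ (m * lam) * (r ^ lam) ^ n := by
      rw [mul_pow, ← pow_mul, ← pow_mul, ← pow_mul, mul_comm n lam]
    have h := hc.pow lam
    rw [e] at h
    rw [hu]
    exact (Nat.mod_modEq _ _).trans (h.trans (by simpa using hg.mul hrn))
  have hu1 : u ≡ 1 [MOD n] :=
    (hu'.of_dvd (dvd_pow_self n two_ne_zero)).trans (by simp [Nat.ModEq])
  have hupos : 1 ≤ u := by
    rcases Nat.eq_zero_or_pos u with h0 | h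
    · rw [h0] at hu1
      exact absurd (Nat.dvd_one.1 ((Nat.modEq_zero_iff_dvd).1 hu1.symm)) hn1.ne'
    · exact h
  have hdvd : n ∣ u - 1 := (Nat.modEq_iff_dvd' hupos).1 hu1.symm
  refine ⟨hdvd, ?_⟩
  obtain ⟨v, hv⟩ := hdvd
  have huv : u = 1 + n * v := by omega
  rw [hv, Nat.mul_div_cancel_left v (by omega)]
  have hvm : v ≡ m * lam [MOD n] := by
    rw [huv, sq] at hu'
    exact Nat.ModEq.mul_left_cancel' (by omega) (Nat.ModEq.add_left_cancel' 1 hu')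
  calc v * μ ≡ m * lam * μ [MOD n] := hvm.mul_right μ
    _ = m * (μ * lam) := by ring
    _ ≡ m * 1 [MOD n] := hμ.mul_left m
    _ = m := mul_one m
end

section
/- Let n be a positive integer and work in the ring ZMod (n²) with g = n + 1. Then for all natural numbers m₁, m₂ and all elements r₁, r₂ of ZMod (n²): (g^{m₁} · r₁^n) · (g^{m₂} · r₂^n) = g^{(m₁ + m₂) mod n} · (r₁ r₂)^n. In particular (n+1)^n = 1 in ZMod (n²), so the product of Paillier encryptions of m₁ and m₂ (with randomness r₁, r₂) is a Paillier encryption of (m₁ + m₂) mod n with randomness r₁ r₂; this is the additive homomorphism E(m₁, r₁) · E(m₂, r₂) = E(m₁ + m₂, r₁ r₂). -/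
theorem add_one_pow_of_sq_eq_zero {R : Type*} [CommSemiring R] {a : R} (ha : a ^ 2 = 0) (k : ℕ) :
    (a + 1) ^ k = k * a + 1 := by
  induction k with
  | zero => simp
  | succ k ih =>
    calc (a + 1) ^ (k + 1) = k * a ^ 2 + ((k + 1) * a + 1) := by rw [pow_succ, ih]; ring
      _ = ((k + 1 : ℕ) : R) * a + 1 := by rw [ha]; push_cast; ring

theorem ZMod.natCast_sq_eq_zero (n : ℕ) : (n : ZMod (n ^ 2)) ^ 2 = 0 := by
  exact_mod_cast ZMod.natCast_self (n ^ 2)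

theorem ZMod.natCast_add_one_pow_self (n : ℕ) : (n + 1 : ZMod (n ^ 2)) ^ n = 1 := by
  rw [add_one_pow_of_sq_eq_zero (ZMod.natCast_sq_eq_zero n), ← sq, ZMod.natCast_sq_eq_zero,
    zero_add]


/-- the additive homomorphism of the Paillier cryptosystem.  In
`ZMod (n²)` with `g = n + 1` one has `g^n = 1`, and the product of encryptions of
`m₁` and `m₂` (with randomness `r₁`, `r₂`) equals the encryption of
`(m₁ + m₂) mod n` with randomness `r₁ r₂`. -/
theorem paillier_additively_homomorphic (n : ℕ) (hn : 0 < n) :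
    ((n + 1 : ZMod (n ^ 2)) ^ n = 1) ∧
    ∀ (m₁ m₂ : ℕ) (r₁ r₂ : ZMod (n ^ 2)),
      ((n + 1 : ZMod (n ^ 2)) ^ m₁ * r₁ ^ n) * ((n + 1 : ZMod (n ^ 2)) ^ m₂ * r₂ ^ n)
        = (n + 1 : ZMod (n ^ 2)) ^ ((m₁ + m₂) % n) * (r₁ * r₂) ^ n := by
  refine ⟨ZMod.natCast_add_one_pow_self n, fun m₁ m₂ r₁ r₂ => ?_⟩
  rw [← pow_eq_pow_mod (m₁ + m₂) (ZMod.natCast_add_one_pow_self n), pow_add, mul_pow,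
    mul_mul_mul_comm]
end
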